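/- Every erasable graph on s+t+1 vertices, for integers t ≥ s > 2, has at most 2s+2t−2 edges. -/

import Mathlib

open SimpleGraph
/-- One step of the erase process with parameters `s`, `t`: delete an edge `e` that is
the unique edge between a set `V₁` of size `s` and a set `V₂` of size `t`, where
`V₁`, `V₂` and one extra vertex `v` partition the vertex set. -/
def EraseStep (s t : ℕ) {V : Type*} (G G' : SimpleGraph V) : Prop :=
  ∃ e ∈ G.edgeSet, G'.edgeSet = G.edgeSet \ {e} ∧
    ∃ (V1 V2 : Set V) (v : V),
      Disjoint V1 V2 ∧ v ∉ V1 ∧ v ∉ V2 ∧ V1 ∪ V2 ∪ {v} = Set.univ ∧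
      V1.ncard = s ∧ V2.ncard = t ∧
      (∃ x ∈ V1, ∃ y ∈ V2, e = s(x, y)) ∧
      ∀ x ∈ V1, ∀ y ∈ V2, G.Adj x y → s(x, y) = e

/-- `G` is erasable (with parameters `s`, `t`): its edges can be deleted one at a time
by erase steps until no edge remains. -/
def Erasable (s t : ℕ) {V : Type*} (G : SimpleGraph V) : Prop :=
  ∃ (m : ℕ) (c : ℕ → SimpleGraph V), c 0 = G ∧ c m = ⊥ ∧
    ∀ i < m, EraseStep s t (c i) (c (i + 1))

set_option linter.unusedSectionVars false

namespace EraseAux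

variable {V : Type*} [Fintype V] [DecidableEq V]

open Classical in
/-- Number of ordered adjacent pairs inside `X`. -/
noncomputable def ec (G : SimpleGraph V) (X : Finset V) : ℕ :=
  ((X ×ˢ X).filter (fun p => G.Adj p.1 p.2)).card

structure Cut (s : ℕ) (G G' : SimpleGraph V) (A B : Finset V) (u x0 y0 : V) : Prop where
  disj : ∀ a, a ∈ A → a ∈ B → False
  uA : u ∉ A
  uB : u ∉ B
  cover : ∀ a, a ∈ A ∨ a ∈ B ∨ a = u
  cA : s ≤ A.card
  cB : s ≤ B.card
  hx : x0 ∈ A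
  hy : y0 ∈ B
  adj : G.Adj x0 y0
  uniq : ∀ a ∈ A, ∀ b ∈ B, G.Adj a b → a = x0 ∧ b = y0
  del : ∀ a b, G'.Adj a b ↔ G.Adj a b ∧ ¬ (a = x0 ∧ b = y0) ∧ ¬ (a = y0 ∧ b = x0)

theorem Cut.swap {s : ℕ} {G G' : SimpleGraph V} {A B : Finset V} {u x0 y0 : V}
    (h : Cut s G G' A B u x0 y0) : Cut s G G' B A u y0 x0 where
  disj a ha hb := h.disj a hb ha
  uA := h.uB
  uB := h.uA
  cover a := by have := h.cover a; tauto
  cA := h.cB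
  cB := h.cA
  hx := h.hy
  hy := h.hx
  adj := h.adj.symm
  uniq a ha b hb hab := by have := h.uniq b hb a ha hab.symm; tauto
  del a b := by have := h.del a b; tauto

def Sparse (G : SimpleGraph V) : Prop := ∀ X : Finset V, 2 ≤ X.card → ec G X + 6 ≤ 4 * X.card

def Tight (G : SimpleGraph V) (X : Finset V) : Prop := 2 ≤ X.card ∧ ec G X + 6 = 4 * X.card

theorem ec_le_one {G : SimpleGraph V} {X : Finset V} (h : X.card ≤ 1) : ec G X = 0 := by
  classical
  unfold ec
  rw [Finset.card_eq_zero, Finset.filter_eq_empty_iff]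
  rintro ⟨a, b⟩ hab hadj
  rw [Finset.mem_product] at hab
  exact hadj.ne (Finset.card_le_one.1 h _ hab.1 _ hab.2)

theorem Sparse.weak {G : SimpleGraph V} (h : Sparse G) {X : Finset V} (hX : X.Nonempty) :
    ec G X + 4 ≤ 4 * X.card := by
  have := hX.card_pos
  by_cases h2 : 2 ≤ X.card
  · have := h X h2; omega
  · rw [ec_le_one (by omega)]; omega

section
variable {s : ℕ} {G G' : SimpleGraph V} {A B : Finset V} {u x0 y0 : V}

theorem Cut.adj' (h : Cut s G G' A B u x0 y0) {a b : V} (hab : G'.Adj a b) :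
    (a ∈ insert u A ∧ b ∈ insert u A) ∨ (a ∈ insert u B ∧ b ∈ insert u B) := by
  have h1 := (h.del a b).1 hab
  have h2 := h.cover a
  have h3 := h.cover b
  have h4 := h.uniq a
  have h5 := h.uniq b
  have h6 := h1.1.symm
  simp only [Finset.mem_insert]
  grind

theorem Cut.ec_le (h : Cut s G G' A B u x0 y0) (X : Finset V) :
    ec G X ≤ ec G' (X ∩ insert u A) + ec G' (X ∩ insert u B) +
      (if x0 ∈ X ∧ y0 ∈ X then 2 else 0) := by
  classical
  unfold ec
  have : ((X ×ˢ X).filter (fun p => G.Adj p.1 p.2)) ⊆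
      (((X ∩ insert u A) ×ˢ (X ∩ insert u A)).filter (fun p => G'.Adj p.1 p.2) ∪
       ((X ∩ insert u B) ×ˢ (X ∩ insert u B)).filter (fun p => G'.Adj p.1 p.2)) ∪
       (if x0 ∈ X ∧ y0 ∈ X then {(x0, y0), (y0, x0)} else ∅) := by
    rintro ⟨a, b⟩ hab
    simp only [Finset.mem_filter, Finset.mem_product] at hab
    by_cases h' : G'.Adj a b
    · have := h.adj' h'
      simp only [Finset.mem_union, Finset.mem_filter, Finset.mem_product, Finset.mem_inter]
      tauto
    · have h2 := h.del a b
      have h3 : (a = x0 ∧ b = y0) ∨ (a = y0 ∧ b = x0) := by tauto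
      have h4 : x0 ∈ X ∧ y0 ∈ X := by
        rcases h3 with ⟨rfl, rfl⟩ | ⟨rfl, rfl⟩ <;> tauto
      rw [if_pos h4]
      rcases h3 with ⟨rfl, rfl⟩ | ⟨rfl, rfl⟩ <;> simp
  refine (Finset.card_le_card this).trans ?_
  refine (Finset.card_union_le _ _).trans ?_
  refine add_le_add (Finset.card_union_le _ _) ?_
  split_ifs
  · exact Finset.card_le_two
  · simp

theorem Cut.card_in (h : Cut s G G' A B u x0 y0) {X : Finset V} (hu : u ∈ X) :
    (X ∩ insert u A).card + (X ∩ insert u B).card = X.card + 1 := by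
  have h1 : (X ∩ insert u A) ∪ (X ∩ insert u B) = X := by
    ext a; have := h.cover a; simp only [Finset.mem_union, Finset.mem_inter, Finset.mem_insert]; tauto
  have h2 : (X ∩ insert u A) ∩ (X ∩ insert u B) = {u} := by
    ext a; have := h.disj a
    simp only [Finset.mem_inter, Finset.mem_insert, Finset.mem_singleton]
    constructor
    · tauto
    · rintro rfl; tauto
  have := Finset.card_union_add_card_inter (X ∩ insert u A) (X ∩ insert u B)
  rw [h1, h2] at this; simpa using this.symm

theorem Cut.card_out (h : Cut s G G' A B u x0 y0) {X : Finset V} (hu : u ∉ X) :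
    (X ∩ insert u A).card + (X ∩ insert u B).card = X.card := by
  have h1 : (X ∩ insert u A) ∪ (X ∩ insert u B) = X := by
    ext a; have := h.cover a
    simp only [Finset.mem_union, Finset.mem_inter, Finset.mem_insert]; tauto
  have h2 : (X ∩ insert u A) ∩ (X ∩ insert u B) = ∅ := by
    ext a; have := h.disj a
    simp only [Finset.mem_inter, Finset.mem_insert, Finset.notMem_empty, iff_false]
    rintro ⟨⟨h1, h2⟩, -, h3⟩
    grind
  have := Finset.card_union_add_card_inter (X ∩ insert u A) (X ∩ insert u B)
  rw [h1, h2] at this; simpa using this.symm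

theorem Cut.ec_eq (h : Cut s G G' A B u x0 y0) {X : Finset V} (hX : ¬ (x0 ∈ X ∧ y0 ∈ X)) :
    ec G X = ec G' X := by
  unfold ec
  congr 1
  ext ⟨a, b⟩
  simp only [Finset.mem_filter, Finset.mem_product, h.del]
  constructor
  · rintro ⟨⟨ha, hb⟩, hab⟩
    refine ⟨⟨ha, hb⟩, hab, ?_, ?_⟩
    · rintro ⟨rfl, rfl⟩; tauto
    · rintro ⟨rfl, rfl⟩; tauto
  · tauto

theorem Cut.side (h : Cut s G G' A B u x0 y0) {X : Finset V}
    (hn : ¬ ((∃ a ∈ X, a ∈ A) ∧ (∃ b ∈ X, b ∈ B))) :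
    (∀ a ∈ X, a ≠ u → a ∈ A) ∨ (∀ a ∈ X, a ≠ u → a ∈ B) := by
  have := h.cover
  by_cases h1 : ∃ a ∈ X, a ∈ A
  · left; intro a ha hu
    rcases this a with h | h | h
    · exact h
    · exact absurd ⟨h1, a, ha, h⟩ hn
    · exact absurd h hu
  · right; intro a ha hu
    rcases this a with h | h | h
    · exact absurd ⟨a, ha, h⟩ h1
    · exact h
    · exact absurd h hu

theorem Cut.two_le (h : Cut s G G' A B u x0 y0) {X : Finset V} (hu : u ∈ X)
    {a : V} (ha : a ∈ X) (haA : a ∈ A) : 2 ≤ (X ∩ insert u A).card := by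
  have : ({u, a} : Finset V) ⊆ X ∩ insert u A := by
    intro z hz
    simp only [Finset.mem_insert, Finset.mem_singleton, Finset.mem_inter] at *
    rcases hz with rfl | rfl <;> tauto
  have h2 := Finset.card_le_card this
  rwa [Finset.card_pair] at h2
  rintro rfl; exact h.uA haA

theorem Cut.sparse (h : Cut s G G' A B u x0 y0) (hs : Sparse G') : Sparse G := by
  intro X hX
  by_cases hn : ((∃ a ∈ X, a ∈ A) ∧ (∃ b ∈ X, b ∈ B))
  · obtain ⟨⟨a, ha, haA⟩, b, hb, hbB⟩ := hn
    have h0 := h.ec_le X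
    have h1 : (if x0 ∈ X ∧ y0 ∈ X then 2 else 0) ≤ 2 := by split_ifs <;> omega
    by_cases hu : u ∈ X
    · have h2 := h.card_in hu
      have h3 := hs _ (h.two_le hu ha haA)
      have h4 := hs _ (h.swap.two_le hu hb hbB)
      omega
    · have h2 := h.card_out hu
      have h3 := hs.weak (X := X ∩ insert u A) ⟨a, by simp [ha, haA]⟩
      have h4 := hs.weak (X := X ∩ insert u B) ⟨b, by simp [hb, hbB]⟩
      omega
  · rw [h.ec_eq]
    · exact hs X hX
    · rintro ⟨h1, h2⟩; exact hn ⟨⟨_, h1, h.hx⟩, _, h2, h.hy⟩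

/-- A tight set not containing the removed edge lies on one side. -/
theorem Cut.tight_out (h : Cut s G G' A B u x0 y0) (hs : Sparse G') {X : Finset V}
    (hX : Tight G X) (hn : ¬ (x0 ∈ X ∧ y0 ∈ X)) :
    Tight G' X ∧ ((∀ a ∈ X, a ≠ u → a ∈ A) ∨ (∀ a ∈ X, a ≠ u → a ∈ B)) := by
  refine ⟨⟨hX.1, by rw [← h.ec_eq hn]; exact hX.2⟩, h.side ?_⟩
  rintro ⟨⟨a, ha, haA⟩, b, hb, hbB⟩
  have h0 := h.ec_le X
  rw [if_neg hn] at h0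
  have h5 := hX.2
  by_cases hu : u ∈ X
  · have h2 := h.card_in hu
    have h3 := hs _ (h.two_le hu ha haA)
    have h4 := hs _ (h.swap.two_le hu hb hbB)
    omega
  · have h2 := h.card_out hu
    have h3 := hs.weak (X := X ∩ insert u A) ⟨a, by simp [ha, haA]⟩
    have h4 := hs.weak (X := X ∩ insert u B) ⟨b, by simp [hb, hbB]⟩
    omega

theorem Cut.tight_in (h : Cut s G G' A B u x0 y0) (hs : Sparse G') {X : Finset V}
    (hX : Tight G X) (hx : x0 ∈ X) (hy : y0 ∈ X) :
    X.card = 2 ∨ (u ∈ X ∧ Tight G' (X ∩ insert u A) ∧ Tight G' (X ∩ insert u B)) := by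
  have h0 := h.ec_le X
  rw [if_pos ⟨hx, hy⟩] at h0
  have h5 := hX.2
  by_cases hu : u ∈ X
  · right
    have h2 := h.card_in hu
    have h6 := (h.two_le hu hx h.hx)
    have h7 := (h.swap.two_le hu hy h.hy)
    have h3 := hs _ h6
    have h4 := hs _ h7
    exact ⟨hu, ⟨h6, by omega⟩, ⟨h7, by omega⟩⟩
  · left
    have h2 := h.card_out hu
    have h3 := hs.weak (X := X ∩ insert u A) ⟨x0, by simp [hx, h.hx]⟩
    have h4 := hs.weak (X := X ∩ insert u B) ⟨y0, by simp [hy, h.hy]⟩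
    have h6 := hs (X ∩ insert u A)
    have h7 := hs (X ∩ insert u B)
    omega

end

structure StI (s : ℕ) (G : SimpleGraph V) (v : V) (P : Finset V → Prop) : Prop where
  nv : ∀ D, P D → v ∉ D
  ne : ∀ D, P D → D.Nonempty
  tight : ∀ D, P D → Tight G (insert v D)
  disj : ∀ D E, P D → P E → D ≠ E → ∀ a, a ∈ D → a ∈ E → False
  cover : ∀ a, a ≠ v → ∃ D, P D ∧ a ∈ D
  two : ∃ D E, P D ∧ P E ∧ D ≠ E
  big : ∀ D, P D → s < D.card → ∀ E, P E → E ≠ D → E.card = s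
  edge : ∀ a b, G.Adj a b → ∃ D, P D ∧ a ∈ insert v D ∧ b ∈ insert v D

structure StII (s : ℕ) (G : SimpleGraph V) (Q : Finset V) (P : Finset V → V → Prop) : Prop where
  card : ∀ L w, P L w → L.card = s
  att : ∀ L w, P L w → w ∈ Q
  nQ : ∀ L w, P L w → ∀ a, a ∈ L → a ∈ Q → False
  tight : ∀ L w, P L w → Tight G (insert w L)
  disj : ∀ L w M z, P L w → P M z → (L = M ∧ w = z) ∨ ∀ a, a ∈ L → a ∈ M → False
  cover : ∀ a, a ∈ Q ∨ ∃ L w, P L w ∧ a ∈ L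
  two : ∃ L w M z, P L w ∧ P M z ∧ w ≠ z
  core : Tight G Q ∨ Q.card = 2
  edge : ∀ a b, G.Adj a b → (a ∈ Q ∧ b ∈ Q) ∨ ∃ L w, P L w ∧ a ∈ insert w L ∧ b ∈ insert w L

def St (s : ℕ) (G : SimpleGraph V) : Prop :=
  (∃ v P, StI s G v P) ∨ (∃ Q P, StII s G Q P)

section
variable {s : ℕ} {G G' : SimpleGraph V} {A B : Finset V} {u x0 y0 : V}

/-- A set of size at least `s` inside `A` missing one point of `A`. -/
theorem no_sub {A L : Finset V} {x : V} (hA : A.card = s) (hL : s ≤ L.card)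
    (hsub : ∀ a ∈ L, a ∈ A) (hx : x ∈ A) (hxL : x ∉ L) : False := by
  have : insert x L ⊆ A := by
    intro a ha; rcases Finset.mem_insert.1 ha with rfl | h
    · exact hx
    · exact hsub a h
  have := Finset.card_le_card this
  rw [Finset.card_insert_of_notMem hxL] at this
  omega

theorem StII.step {Q : Finset V} {P : Finset V → V → Prop} (h : Cut s G G' A B u x0 y0)
    (hA : A.card = s) (hs3 : 2 ≤ s) (hs : Sparse G') (H : StII s G Q P) : St s G' := by
  right
  have hne : x0 ≠ y0 := h.adj.ne
  by_cases hQ : x0 ∈ Q ∧ y0 ∈ Q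
  · have hout : ∀ L w, P L w → ¬ (x0 ∈ insert w L ∧ y0 ∈ insert w L) := by
      rintro L w hL ⟨h1, h2⟩
      have := H.nQ L w hL
      simp only [Finset.mem_insert] at h1 h2
      grind
    by_cases hc : Q.card = 2
    · refine ⟨Q, P, H.card, H.att, H.nQ, ?_, H.disj, H.cover, H.two, Or.inr hc, ?_⟩
      · intro L w hL
        exact (h.tight_out hs (H.tight L w hL) (hout L w hL)).1
      · intro a b hab
        exact H.edge a b ((h.del a b).1 hab).1
    · have hT : Tight G Q := H.core.resolve_right hc
      obtain ⟨huQ, hTA, hTB⟩ := (h.tight_in hs hT hQ.1 hQ.2).resolve_left hc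
      have hL : ∀ L w, P L w → ∀ a ∈ insert w L, a ∉ A := by
        intro L w hL
        have huL : u ∉ L := fun hu => H.nQ L w hL u hu huQ
        have hxL : x0 ∉ L := fun hu => H.nQ L w hL _ hu hQ.1
        rcases (h.tight_out hs (H.tight L w hL) (hout L w hL)).2 with h1 | h1
        · exfalso
          refine no_sub hA (H.card L w hL).ge (fun a ha => ?_) h.hx hxL
          exact h1 a (Finset.mem_insert_of_mem ha) (by rintro rfl; exact huL ha)
        · intro a ha haA
          by_cases hau : a = u
          · subst hau; exact h.uA haA
          · exact h.disj a haA (h1 a ha hau)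
      have hAQ : ∀ a ∈ A, a ∈ Q := by
        intro a ha
        rcases H.cover a with h1 | ⟨L, w, hP, haL⟩
        · exact h1
        · exact absurd ha (hL L w hP a (Finset.mem_insert_of_mem haL))
      have hQA : Q ∩ insert u A = insert u A := by
        ext a; simp only [Finset.mem_inter, Finset.mem_insert]
        constructor
        · tauto
        · rintro (rfl | h1)
          · tauto
          · exact ⟨hAQ a h1, Or.inr h1⟩
      rw [hQA] at hTA
      have hQm : ∀ a, a ∈ Q ∩ insert u B ↔ a ∈ Q ∧ a ∉ A := by
        intro a
        have h1 := h.cover a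
        have h2 := h.disj a
        have h3 := h.uA
        simp only [Finset.mem_inter, Finset.mem_insert]
        grind
      have hold : ∀ L w, P L w → w ∈ Q ∩ insert u B := fun L w hP =>
        (hQm w).2 ⟨H.att L w hP, hL L w hP w (Finset.mem_insert_self _ _)⟩
      refine ⟨Q ∩ insert u B, fun L w => P L w ∨ (L = A ∧ w = u), ?_, ?_, ?_, ?_, ?_, ?_, ?_,
        Or.inl hTB, ?_⟩
      · rintro L w (hP | ⟨rfl, rfl⟩)
        · exact H.card L w hP
        · exact hA
      · rintro L w (hP | ⟨rfl, rfl⟩)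
        · exact hold L w hP
        · simp [huQ]
      · rintro L w (hP | ⟨rfl, rfl⟩) a ha haQ
        · exact H.nQ L w hP a ha ((hQm a).1 haQ).1
        · exact ((hQm a).1 haQ).2 ha
      · rintro L w (hP | ⟨rfl, rfl⟩)
        · exact (h.tight_out hs (H.tight L w hP) (hout L w hP)).1
        · exact hTA
      · rintro L w M z (hP | ⟨rfl, rfl⟩) (hP' | ⟨rfl, rfl⟩)
        · exact H.disj L w M z hP hP'
        · right; intro a ha; exact hL L w hP a (Finset.mem_insert_of_mem ha)
        · right; intro a ha ha'; exact hL M z hP' a (Finset.mem_insert_of_mem ha') ha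
        · left; simp
      · intro a
        by_cases haA : a ∈ A
        · right; exact ⟨A, u, Or.inr ⟨rfl, rfl⟩, haA⟩
        · rcases H.cover a with h1 | ⟨L, w, hP, haL⟩
          · left; exact (hQm a).2 ⟨h1, haA⟩
          · right; exact ⟨L, w, Or.inl hP, haL⟩
      · obtain ⟨L, w, M, z, h1, h2, h3⟩ := H.two
        exact ⟨L, w, M, z, Or.inl h1, Or.inl h2, h3⟩
      · intro a b hab
        rcases H.edge a b ((h.del a b).1 hab).1 with h1 | ⟨L, w, hP, h1⟩
        · rcases h.adj' hab with h2 | h2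
          · right; exact ⟨A, u, Or.inr ⟨rfl, rfl⟩, h2⟩
          · left; exact ⟨Finset.mem_inter.2 ⟨h1.1, h2.1⟩, Finset.mem_inter.2 ⟨h1.2, h2.2⟩⟩
        · right; exact ⟨L, w, Or.inl hP, h1⟩
  · exfalso
    obtain ⟨L, w, hP, hxL, hyL⟩ := (H.edge x0 y0 h.adj).resolve_left hQ
    have hwQ := H.att L w hP
    have hLQ := H.nQ L w hP
    have hwL : w ∉ L := fun hw => hLQ w hw hwQ
    have hcard : (insert w L).card = s + 1 := by
      rw [Finset.card_insert_of_notMem hwL, H.card L w hP]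
    obtain ⟨hu, -, -⟩ := (h.tight_in hs (H.tight L w hP) hxL hyL).resolve_left (by omega)
    obtain ⟨M, z, hPM, hzw⟩ : ∃ M z, P M z ∧ z ≠ w := by
      obtain ⟨L1, w1, M1, z1, h1, h2, h3⟩ := H.two
      by_cases hw : w1 = w
      · exact ⟨M1, z1, h2, by rintro rfl; exact h3 hw⟩
      · exact ⟨L1, w1, h1, hw⟩
    have hN : ∀ N q, P N q → (N ≠ L ∨ q ≠ w) → ∀ a, a ∈ insert w L → a ∉ N := by
      intro N q hPN hNe a ha haN
      have h1 := H.disj L w N q hP hPN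
      have h2 := H.nQ N q hPN a haN
      simp only [Finset.mem_insert] at ha
      grind
    have hNB : ∀ N q, P N q → (N ≠ L ∨ q ≠ w) → ∀ a ∈ insert q N, a ≠ u → a ∈ B := by
      intro N q hPN hNe
      have h1 := hN N q hPN hNe
      have hq := H.att N q hPN
      have hout : ¬ (x0 ∈ insert q N ∧ y0 ∈ insert q N) := by
        rintro ⟨h2, h3⟩
        have h4 := h1 x0 hxL
        have h5 := h1 y0 hyL
        simp only [Finset.mem_insert] at h2 h3
        grind
      rcases (h.tight_out hs (H.tight N q hPN) hout).2 with h2 | h2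
      · exfalso
        refine no_sub hA (H.card N q hPN).ge (fun a ha => ?_) h.hx (h1 x0 hxL)
        exact h2 a (Finset.mem_insert_of_mem ha) (by rintro rfl; exact h1 _ hu ha)
      · exact h2
    have hzQ := H.att M z hPM
    have hzu : z ≠ u := by
      rintro rfl
      rcases Finset.mem_insert.1 hu with h1 | h1
      · exact hzw h1
      · exact hLQ _ h1 hzQ
    have hzB : z ∈ B := hNB M z hPM (Or.inr hzw) z (Finset.mem_insert_self _ _) hzu
    have hQA : ∀ a ∈ Q, a ∈ A → a = w := by
      intro a haQ haA
      rcases H.core with hT | hc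
      · rcases (h.tight_out hs hT hQ).2 with h1 | h1
        · exact absurd hzB (fun hb => h.disj z (h1 z hzQ hzu) hb)
        · exact absurd (h1 a haQ (by rintro rfl; exact h.uA haA)) (fun hb => h.disj a haA hb)
      · by_contra haw
        have haz : a ≠ z := by rintro rfl; exact h.disj _ haA hzB
        have : ({a, w, z} : Finset V) ⊆ Q := by
          intro b hb; simp only [Finset.mem_insert, Finset.mem_singleton] at hb
          rcases hb with rfl | rfl | rfl <;> assumption
        have h3 := Finset.card_le_card this
        rw [Finset.card_eq_three.2 ⟨a, w, z, haw, haz, hzw.symm, rfl⟩] at h3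
        omega
    have hsub : A ⊆ ((insert w L).erase u).erase y0 := by
      intro a ha
      rw [Finset.mem_erase, Finset.mem_erase]
      refine ⟨by rintro rfl; exact h.disj _ ha h.hy, by rintro rfl; exact h.uA ha, ?_⟩
      rcases H.cover a with h1 | ⟨N, q, hPN, haN⟩
      · rw [hQA a h1 ha]; exact Finset.mem_insert_self _ _
      · by_cases hNe : N ≠ L ∨ q ≠ w
        · exact absurd (hNB N q hPN hNe a (Finset.mem_insert_of_mem haN)
            (by rintro rfl; exact h.uA ha)) (fun hb => h.disj a ha hb)
        · push Not at hNe
          rw [← hNe.1]; exact Finset.mem_insert_of_mem haN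
    have h1 := Finset.card_le_card hsub
    rw [Finset.card_erase_of_mem, Finset.card_erase_of_mem hu] at h1
    · omega
    · rw [Finset.mem_erase]; exact ⟨by rintro rfl; exact h.uB h.hy, hyL⟩

theorem StI.no_bridge {v : V} {P : Finset V → Prop} (h : Cut s G G' A B u x0 y0)
    (hs3 : 2 ≤ s) {D : Finset V} (hvD : v ∉ D) (hc : (insert v D).card = 2)
    (hxD : x0 ∈ insert v D) (hyD : y0 ∈ insert v D)
    (cover : ∀ a, a ≠ v → ∃ D, P D ∧ a ∈ D)
    (hE : ∀ E, P E → E ≠ D → ((∀ a ∈ insert v E, a ≠ u → a ∈ A) ∨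
      (∀ a ∈ insert v E, a ≠ u → a ∈ B))) (hv : v = x0) : False := by
  subst hv
  have hD1 : D.card ≤ 1 := by rw [Finset.card_insert_of_notMem hvD] at hc; omega
  have hy : y0 ∈ D := by
    rcases Finset.mem_insert.1 hyD with h1 | h1
    · exact absurd h1.symm h.adj.ne
    · exact h1
  have : B ⊆ {y0} := by
    intro b hb
    rw [Finset.mem_singleton]
    have hbv : b ≠ v := by rintro rfl; exact h.disj _ h.hx hb
    have hbu : b ≠ u := by rintro rfl; exact h.uB hb
    have hvu : v ≠ u := by rintro rfl; exact h.uA h.hx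
    obtain ⟨E, hPE, hbE⟩ := cover b hbv
    by_cases hED : E = D
    · subst hED; exact Finset.card_le_one.1 hD1 _ hbE _ hy
    · exfalso
      rcases hE E hPE hED with h1 | h1
      · exact h.disj b (h1 b (Finset.mem_insert_of_mem hbE) hbu) hb
      · exact h.disj v h.hx (h1 v (Finset.mem_insert_self _ _) hvu)
  have h1 := Finset.card_le_card this
  have h2 := h.cB
  rw [Finset.card_singleton] at h1
  omega

theorem StI.step {v : V} {P : Finset V → Prop} (h : Cut s G G' A B u x0 y0)
    (hA : A.card = s) (hs3 : 2 ≤ s) (hs : Sparse G') (H : StI s G v P) : St s G' := by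
  have hne : x0 ≠ y0 := h.adj.ne
  obtain ⟨D, hD, hxD, hyD⟩ := H.edge x0 y0 h.adj
  have hvD := H.nv D hD
  have hout : ∀ E, P E → E ≠ D → ¬ (x0 ∈ insert v E ∧ y0 ∈ insert v E) := by
    rintro E hE hED ⟨h1, h2⟩
    have := H.disj E D hE hD hED
    simp only [Finset.mem_insert] at h1 h2 hxD hyD
    grind
  have hE : ∀ E, P E → E ≠ D → ((∀ a ∈ insert v E, a ≠ u → a ∈ A) ∨
      (∀ a ∈ insert v E, a ≠ u → a ∈ B)) := fun E hE hED =>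
    (h.tight_out hs (H.tight E hE) (hout E hE hED)).2
  have hET : ∀ E, P E → E ≠ D → Tight G' (insert v E) := fun E hE hED =>
    (h.tight_out hs (H.tight E hE) (hout E hE hED)).1
  obtain ⟨Z, hZ, hZD⟩ : ∃ Z, P Z ∧ Z ≠ D := by
    obtain ⟨E, F, h1, h2, h3⟩ := H.two
    by_cases hw : E = D
    · exact ⟨F, h2, by rintro rfl; exact h3 hw⟩
    · exact ⟨E, h1, hw⟩
  rcases h.tight_in hs (H.tight D hD) hxD hyD with hc | ⟨hu, hTA, hTB⟩
  · exfalso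
    have hv : v = x0 ∨ v = y0 := by
      by_contra hcon
      push Not at hcon
      have h1 : ({v, x0, y0} : Finset V) ⊆ insert v D := by
        intro b hb; simp only [Finset.mem_insert, Finset.mem_singleton] at hb
        rcases hb with rfl | rfl | rfl
        · exact Finset.mem_insert_self _ _
        · assumption
        · assumption
      have h3 := Finset.card_le_card h1
      rw [Finset.card_eq_three.2 ⟨v, x0, y0, hcon.1, hcon.2, hne, rfl⟩] at h3
      omega
    rcases hv with hv | hv
    · exact StI.no_bridge h hs3 hvD hc hxD hyD H.cover hE hv
    · exact StI.no_bridge h.swap hs3 hvD hc hyD hxD H.cover (fun E h1 h2 => (hE E h1 h2).symm) hv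
  by_cases huv : u = v
  · left
    subst huv
    have hxD' : x0 ∈ D := by
      rcases Finset.mem_insert.1 hxD with h1 | h1
      · exact absurd h.hx (h1 ▸ h.uA)
      · exact h1
    have hyD' : y0 ∈ D := by
      rcases Finset.mem_insert.1 hyD with h1 | h1
      · exact absurd h.hy (h1 ▸ h.uB)
      · exact h1
    have e1 : insert u D ∩ insert u A = insert u (D ∩ A) := (Finset.insert_inter_distrib _ _ _).symm
    have e2 : insert u D ∩ insert u B = insert u (D ∩ B) := (Finset.insert_inter_distrib _ _ _).symm
    rw [e1] at hTA
    rw [e2] at hTB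
    have hsplit : D.card = (D ∩ A).card + (D ∩ B).card := by
      have := h.card_in hu
      rw [e1, e2, Finset.card_insert_of_notMem, Finset.card_insert_of_notMem,
        Finset.card_insert_of_notMem hvD] at this
      · omega
      · simp [hvD]
      · simp [hvD]
    have hApos : 0 < (D ∩ A).card := Finset.card_pos.2 ⟨x0, by simp [hxD', h.hx]⟩
    have hBpos : 0 < (D ∩ B).card := Finset.card_pos.2 ⟨y0, by simp [hyD', h.hy]⟩
    have hAsub : (∀ E, P E → E ≠ D → (∃ a ∈ E, a ∈ A) → E.card = s) → D ∩ A = A := by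
      intro hall
      apply Finset.inter_eq_right.2
      intro a ha
      have hau : a ≠ u := by rintro rfl; exact h.uA ha
      obtain ⟨E, hPE, haE⟩ := H.cover a hau
      by_cases hED : E = D
      · exact hED ▸ haE
      · exfalso
        have huE := H.nv E hPE
        rcases hE E hPE hED with h1 | h1
        · refine no_sub hA (hall E hPE hED ⟨a, haE, ha⟩).ge (fun b hb => ?_) h.hx
            (fun hxE => H.disj E D hPE hD hED x0 hxE hxD')
          exact h1 b (Finset.mem_insert_of_mem hb) (by rintro rfl; exact huE hb)
        · exact h.disj a ha (h1 a (Finset.mem_insert_of_mem haE) hau)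
    refine ⟨u, fun E => (P E ∧ E ≠ D) ∨ E = D ∩ A ∨ E = D ∩ B, ?_, ?_, ?_, ?_, ?_, ?_, ?_, ?_⟩
    · rintro E (⟨h1, -⟩ | rfl | rfl)
      · exact H.nv E h1
      · simp [hvD]
      · simp [hvD]
    · rintro E (⟨h1, -⟩ | rfl | rfl)
      · exact H.ne E h1
      · exact Finset.card_pos.1 hApos
      · exact Finset.card_pos.1 hBpos
    · rintro E (⟨h1, h2⟩ | rfl | rfl)
      · exact hET E h1 h2
      · exact hTA
      · exact hTB
    · have hd := fun E hPE hED => H.disj E D hPE hD hED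
      have hAB := h.disj
      rintro E F (⟨h1, h2⟩ | rfl | rfl) (⟨h3, h4⟩ | rfl | rfl) hEF a haE haF
      · exact H.disj E F h1 h3 hEF a haE haF
      · exact hd E h1 h2 a haE (Finset.mem_inter.1 haF).1
      · exact hd E h1 h2 a haE (Finset.mem_inter.1 haF).1
      · exact hd F h3 h4 a haF (Finset.mem_inter.1 haE).1
      · exact hEF rfl
      · exact hAB a (Finset.mem_inter.1 haE).2 (Finset.mem_inter.1 haF).2
      · exact hd F h3 h4 a haF (Finset.mem_inter.1 haE).1
      · exact hAB a (Finset.mem_inter.1 haF).2 (Finset.mem_inter.1 haE).2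
      · exact hEF rfl
    · intro a ha
      obtain ⟨E, hPE, haE⟩ := H.cover a ha
      by_cases hED : E = D
      · subst hED
        rcases h.cover a with h1 | h1 | h1
        · exact ⟨_, Or.inr (Or.inl rfl), Finset.mem_inter.2 ⟨haE, h1⟩⟩
        · exact ⟨_, Or.inr (Or.inr rfl), Finset.mem_inter.2 ⟨haE, h1⟩⟩
        · exact absurd h1 ha
      · exact ⟨E, Or.inl ⟨hPE, hED⟩, haE⟩
    · refine ⟨D ∩ A, D ∩ B, Or.inr (Or.inl rfl), Or.inr (Or.inr rfl), ?_⟩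
      intro heq
      have : x0 ∈ D ∩ A := by simp [hxD', h.hx]
      rw [heq] at this
      exact h.disj x0 h.hx (Finset.mem_inter.1 this).2
    · rintro F (⟨h1, h2⟩ | rfl | rfl) hF E hE' hEF
      · exfalso
        exfalso
        have hb := H.big F h1 hF
        have hDs := hb D hD (Ne.symm h2)
        have := hAsub (fun E hPE hED hex => by
          by_cases hEF : E = F
          · exfalso
            subst hEF
            obtain ⟨a, haE, haA⟩ := hex
            have hau : a ≠ u := by rintro rfl; exact h.uA haA
            rcases hE E hPE hED with h3 | h3
            · have : E ⊆ A := fun b hb => h3 b (Finset.mem_insert_of_mem hb)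
                (by rintro rfl; exact H.nv E hPE hb)
              have := Finset.card_le_card this
              omega
            · exact h.disj a haA (h3 a (Finset.mem_insert_of_mem haE) hau)
          · exact hb E hPE hEF)
        rw [this] at hsplit
        omega
      · exfalso
        have := Finset.card_le_card (Finset.inter_subset_right : D ∩ A ⊆ A)
        omega
      · have hb := H.big D hD (by omega)
        rcases hE' with ⟨h3, h4⟩ | rfl | rfl
        · exact hb E h3 h4
        · rw [hAsub (fun E hPE hED _ => hb E hPE hED), hA]
        · exact absurd rfl hEF
    · intro a b hab
      obtain ⟨E, hPE, haE, hbE⟩ := H.edge a b ((h.del a b).1 hab).1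
      by_cases hED : E = D
      · subst hED
        rcases h.adj' hab with h2 | h2
        · refine ⟨_, Or.inr (Or.inl rfl), ?_, ?_⟩ <;> rw [← e1]
          · exact Finset.mem_inter.2 ⟨haE, h2.1⟩
          · exact Finset.mem_inter.2 ⟨hbE, h2.2⟩
        · refine ⟨_, Or.inr (Or.inr rfl), ?_, ?_⟩ <;> rw [← e2]
          · exact Finset.mem_inter.2 ⟨haE, h2.1⟩
          · exact Finset.mem_inter.2 ⟨hbE, h2.2⟩
      · exact ⟨E, Or.inl ⟨hPE, hED⟩, haE, hbE⟩
  · right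
    have huD : u ∈ D := (Finset.mem_insert.1 hu).resolve_left huv
    have hvu : v ≠ u := fun h => huv h.symm
    have huE : ∀ E, P E → E ≠ D → u ∉ E := fun E hPE hED huE => H.disj E D hPE hD hED u huE huD
    have hvB : v ∈ B := by
      rcases h.cover v with h1 | h1 | h1
      · exfalso
        have hEA : ∀ E, P E → E ≠ D → ∀ a ∈ E, a ∈ A := by
          intro E hPE hED a ha
          rcases hE E hPE hED with h2 | h2
          · exact h2 a (Finset.mem_insert_of_mem ha) (by rintro rfl; exact huE E hPE hED ha)
          · exact absurd (h2 v (Finset.mem_insert_self _ _) hvu) (fun hb => h.disj v h1 hb)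
        have hBD : insert u B ⊆ D := by
          intro b hb
          rcases Finset.mem_insert.1 hb with rfl | hb
          · exact huD
          obtain ⟨E, hPE, hbE⟩ := H.cover b (by rintro rfl; exact h.disj _ h1 hb)
          by_cases hED : E = D
          · exact hED ▸ hbE
          · exact absurd hb (fun hb => h.disj b (hEA E hPE hED b hbE) hb)
        have h3 := Finset.card_le_card hBD
        rw [Finset.card_insert_of_notMem h.uB] at h3
        have h4 := h.cB
        have h5 := H.big D hD (by omega) Z hZ hZD
        exact no_sub hA h5.ge (hEA Z hZ hZD) h1 (H.nv Z hZ)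
      · exact h1
      · exact absurd h1 hvu
    have hEB : ∀ E, P E → E ≠ D → ∀ a ∈ E, a ∈ B := by
      intro E hPE hED a ha
      rcases hE E hPE hED with h2 | h2
      · exact absurd (h2 v (Finset.mem_insert_self _ _) hvu) (fun hb => h.disj v hb hvB)
      · exact h2 a (Finset.mem_insert_of_mem ha) (by rintro rfl; exact huE E hPE hED ha)
    have hAD : insert u A ⊆ D := by
      intro b hb
      rcases Finset.mem_insert.1 hb with rfl | hb
      · exact huD
      obtain ⟨E, hPE, hbE⟩ := H.cover b (by rintro rfl; exact h.disj _ hb hvB)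
      by_cases hED : E = D
      · exact hED ▸ hbE
      · exact absurd hb (fun hb => h.disj b hb (hEB E hPE hED b hbE))
    have h3 := Finset.card_le_card hAD
    rw [Finset.card_insert_of_notMem h.uA] at h3
    have hbig := H.big D hD (by omega)
    have e1 : insert v D ∩ insert u A = insert u A :=
      Finset.inter_eq_right.2 (hAD.trans (Finset.subset_insert _ _))
    rw [e1] at hTA
    refine ⟨insert v D ∩ insert u B, fun L w => (P L ∧ L ≠ D ∧ w = v) ∨ (L = A ∧ w = u),
      ?_, ?_, ?_, ?_, ?_, ?_, ?_, Or.inl hTB, ?_⟩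
    · rintro L w (⟨h1, h2, rfl⟩ | ⟨rfl, rfl⟩)
      · exact hbig L h1 h2
      · exact hA
    · rintro L w (⟨h1, h2, rfl⟩ | ⟨rfl, rfl⟩)
      · simp [hvB]
      · simp [huD]
    · rintro L w (⟨h1, h2, rfl⟩ | ⟨rfl, rfl⟩) a ha haQ
      · rcases Finset.mem_insert.1 (Finset.mem_inter.1 haQ).1 with h4 | h4
        · exact H.nv L h1 (h4 ▸ ha)
        · exact H.disj L D h1 hD h2 a ha h4
      · rcases Finset.mem_insert.1 (Finset.mem_inter.1 haQ).2 with h4 | h4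
        · exact h.uA (h4 ▸ ha)
        · exact h.disj a ha h4
    · rintro L w (⟨h1, h2, rfl⟩ | ⟨rfl, rfl⟩)
      · exact hET L h1 h2
      · exact hTA
    · rintro L w M z (⟨h1, h2, rfl⟩ | ⟨rfl, rfl⟩) (⟨h4, h5, rfl⟩ | ⟨rfl, rfl⟩)
      · by_cases hLM : L = M
        · left; exact ⟨hLM, rfl⟩
        · right; exact H.disj L M h1 h4 hLM
      · right; intro a ha haA; exact h.disj a haA (hEB L h1 h2 a ha)
      · right; intro a haA ha; exact h.disj a haA (hEB M h4 h5 a ha)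
      · left; simp
    · intro a
      rcases h.cover a with h1 | h1 | h1
      · right; exact ⟨A, u, Or.inr ⟨rfl, rfl⟩, h1⟩
      · by_cases hav : a = v
        · left; subst hav; simp [hvB]
        · obtain ⟨E, hPE, haE⟩ := H.cover a hav
          by_cases hED : E = D
          · subst hED; left; simp [haE, h1]
          · right; exact ⟨E, v, Or.inl ⟨hPE, hED, rfl⟩, haE⟩
      · left; subst h1; simp [huD]
    · exact ⟨Z, v, A, u, Or.inl ⟨hZ, hZD, rfl⟩, Or.inr ⟨rfl, rfl⟩, hvu⟩
    · intro a b hab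
      obtain ⟨E, hPE, haE, hbE⟩ := H.edge a b ((h.del a b).1 hab).1
      by_cases hED : E = D
      · subst hED
        rcases h.adj' hab with h2 | h2
        · right; exact ⟨A, u, Or.inr ⟨rfl, rfl⟩, h2⟩
        · left; exact ⟨Finset.mem_inter.2 ⟨haE, h2.1⟩, Finset.mem_inter.2 ⟨hbE, h2.2⟩⟩
      · right; exact ⟨E, v, Or.inl ⟨hPE, hED, rfl⟩, haE, hbE⟩

theorem St.step (h : Cut s G G' A B u x0 y0)
    (hA : A.card = s) (hs3 : 2 ≤ s) (hs : Sparse G') (H : St s G) : St s G' := by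
  rcases H with ⟨v, P, H⟩ | ⟨Q, P, H⟩
  · exact H.step h hA hs3 hs
  · exact H.step h hA hs3 hs

theorem ec_bot (X : Finset V) : ec (⊥ : SimpleGraph V) X = 0 := by
  simp [ec]

theorem not_tight_bot (X : Finset V) : ¬ Tight (⊥ : SimpleGraph V) X := by
  rintro ⟨h1, h2⟩
  rw [ec_bot] at h2
  omega

theorem St.not_bot : ¬ St s (⊥ : SimpleGraph V) := by
  rintro (⟨v, P, H⟩ | ⟨Q, P, H⟩)
  · obtain ⟨D, E, h1, h2, h3⟩ := H.two
    exact not_tight_bot _ (H.tight D h1)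
  · obtain ⟨L, w, M, z, h1, h2, h3⟩ := H.two
    exact not_tight_bot _ (H.tight L w h1)

/-- The first step. -/
theorem St.first (h : Cut s G G' A B u x0 y0) (hA : A.card = s) (hs3 : 2 ≤ s)
    (hs : Sparse G') (hT : Tight G Finset.univ) : St s G' := by
  left
  have hV : (Finset.univ : Finset V).card ≠ 2 := by
    have h1 := Finset.card_le_card (Finset.subset_univ (insert u A))
    rw [Finset.card_insert_of_notMem h.uA] at h1
    omega
  obtain ⟨-, hTA, hTB⟩ := (h.tight_in hs hT (Finset.mem_univ _) (Finset.mem_univ _)).resolve_left hV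
  rw [Finset.univ_inter] at hTA hTB
  have hAB : A ≠ B := by rintro rfl; exact h.disj _ h.hx h.hx
  refine ⟨u, fun E => E = A ∨ E = B, ?_, ?_, ?_, ?_, ?_, ⟨A, B, Or.inl rfl, Or.inr rfl, hAB⟩, ?_, ?_⟩
  · rintro E (rfl | rfl)
    · exact h.uA
    · exact h.uB
  · rintro E (rfl | rfl)
    · exact ⟨_, h.hx⟩
    · exact ⟨_, h.hy⟩
  · rintro E (rfl | rfl) <;> assumption
  · rintro E F (rfl | rfl) (rfl | rfl) hEF a ha hb
    · exact hEF rfl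
    · exact h.disj a ha hb
    · exact h.disj a hb ha
    · exact hEF rfl
  · intro a ha
    rcases h.cover a with h1 | h1 | h1
    · exact ⟨A, Or.inl rfl, h1⟩
    · exact ⟨B, Or.inr rfl, h1⟩
    · exact absurd h1 ha
  · rintro E (rfl | rfl) hE F (rfl | rfl) hF
    · exact hA
    · omega
    · exact hA
    · exact absurd rfl hF
  · intro a b hab
    rcases h.adj' hab with h1 | h1
    · exact ⟨A, Or.inl rfl, h1⟩
    · exact ⟨B, Or.inr rfl, h1⟩

end

theorem cut_of_step {s t : ℕ} (hst : s ≤ t) {G G' : SimpleGraph V} (h : EraseStep s t G G') :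
    ∃ A B u x0 y0, Cut s G G' A B u x0 y0 ∧ A.card = s := by
  classical
  obtain ⟨e, he, hdel, V1, V2, v, hd, hv1, hv2, hcov, hc1, hc2, ⟨x, hx, y, hy, rfl⟩, huniq⟩ := h
  have key : ∀ a ∈ V1, ∀ b ∈ V2, G.Adj a b → a = x ∧ b = y := by
    intro a ha b hb hab
    have := huniq a ha b hb hab
    rw [Sym2.eq_iff] at this
    rcases this with h1 | ⟨rfl, rfl⟩
    · exact h1
    · exact (Set.disjoint_left.1 hd ha hy).elim
  refine ⟨V1.toFinset, V2.toFinset, v, x, y, ⟨?_, ?_, ?_, ?_, ?_, ?_, ?_, ?_, he, ?_, ?_⟩, ?_⟩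
  · intro a ha hb
    simp only [Set.mem_toFinset] at ha hb
    exact Set.disjoint_left.1 hd ha hb
  · simpa using hv1
  · simpa using hv2
  · intro a
    have : a ∈ V1 ∪ V2 ∪ {v} := by rw [hcov]; trivial
    simp only [Set.mem_toFinset]
    rcases this with (h | h) | h
    · tauto
    · tauto
    · right; right; exact h
  · rw [← Set.ncard_eq_toFinset_card']; omega
  · rw [← Set.ncard_eq_toFinset_card']; omega
  · simpa using hx
  · simpa using hy
  · intro a ha b hb hab
    simp only [Set.mem_toFinset] at ha hb
    exact key a ha b hb hab
  · intro a b
    rw [← SimpleGraph.mem_edgeSet, hdel, Set.mem_sdiff, SimpleGraph.mem_edgeSet,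
      Set.mem_singleton_iff, Sym2.eq_iff]
    tauto
  · rw [← Set.ncard_eq_toFinset_card']; omega

theorem sparse_bot : Sparse (⊥ : SimpleGraph V) := by
  intro X hX; rw [ec_bot]; omega

theorem ec_univ (G : SimpleGraph V) : ec G Finset.univ = 2 * G.edgeSet.ncard := by
  classical
  rw [Set.ncard_eq_toFinset_card', ← SimpleGraph.edgeFinset,
    ← SimpleGraph.sum_degrees_eq_twice_card_edges]
  unfold ec
  rw [Finset.card_filter, Finset.univ_product_univ, Fintype.sum_prod_type]
  refine Finset.sum_congr rfl fun a _ => ?_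
  rw [← Finset.card_filter, ← SimpleGraph.card_neighborFinset_eq_degree,
    SimpleGraph.neighborFinset_eq_filter]

end EraseAux

open EraseAux

/-- Every erasable graph on `s+t+1` vertices, for `t ≥ s > 2`, has at most
`2s+2t−2` edges. -/
theorem erasable_edge_bound (s t : ℕ) (hs : 2 < s) (hst : s ≤ t)
    (G : SimpleGraph (Fin (s + t + 1))) (hG : Erasable s t G) :
    G.edgeSet.ncard ≤ 2 * s + 2 * t - 2 := by
  obtain ⟨m, c, h0, hm, hstep⟩ := hG
  have hsp : ∀ k, k ≤ m → Sparse (c (m - k)) := by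
    intro k
    induction k with
    | zero => intro _; simp only [Nat.sub_zero, hm]; exact sparse_bot
    | succ k ih =>
      intro hk
      obtain ⟨A, B, u, x0, y0, hc, -⟩ := cut_of_step hst (hstep (m - (k + 1)) (by omega))
      refine hc.sparse ?_
      rw [show m - (k + 1) + 1 = m - k by omega]
      exact ih (by omega)
  have hsp' : ∀ i, i ≤ m → Sparse (c i) := by
    intro i hi
    have := hsp (m - i) (by omega)
    rwa [show m - (m - i) = i by omega] at this
  by_contra hcon
  have h1 := hsp' 0 (by omega) Finset.univ (by rw [Finset.card_univ, Fintype.card_fin]; omega)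
  rw [h0, ec_univ, Finset.card_univ, Fintype.card_fin] at h1
  have hT : Tight (c 0) Finset.univ := by
    refine ⟨by rw [Finset.card_univ, Fintype.card_fin]; omega, ?_⟩
    rw [h0, ec_univ, Finset.card_univ, Fintype.card_fin]
    omega
  have hmpos : 0 < m := by
    rcases Nat.eq_zero_or_pos m with h | h
    · subst h; rw [hm] at hT; exact absurd hT (not_tight_bot _)
    · exact h
  have hall : ∀ i, i < m → St s (c (i + 1)) := by
    intro i
    induction i with
    | zero =>
      intro hi
      obtain ⟨A, B, u, x0, y0, hc, hA⟩ := cut_of_step hst (hstep 0 hi)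
      exact St.first hc hA (by omega) (hsp' _ (by omega)) hT
    | succ i ih =>
      intro hi
      obtain ⟨A, B, u, x0, y0, hc, hA⟩ := cut_of_step hst (hstep (i + 1) hi)
      exact St.step hc hA (by omega) (hsp' _ (by omega)) (ih (by omega))
  have := hall (m - 1) (by omega)
  rw [show m - 1 + 1 = m by omega, hm] at this
  exact St.not_bot this
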